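/- arXiv:2410.17208 — 6 statements merged into one kernel-verified Lean document; each statement's English description precedes it below -/
import Mathlib

section
/- Let ℓ be a nonzero n-dimensional sequence with finite support, let p_ℓ = Σ_γ ℓ(γ)·X^γ be its generating polynomial, and let d be the multidegree of p_ℓ (d i = degreeOf i p_ℓ). Then for every nonzero polynomial f with degreeOf i f ≤ d i for all i: f ∈ ann(ℓ) if and only if rec_d(f) lies in the orthogonal, under the apolarity pairing, of the principal ideal generated by rec(p_ℓ); equivalently, if and only if ⟨rec_d(f), X^τ · rec(p_ℓ)⟩ = 0 for every exponent vector τ. -/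
open MvPolynomial

/-- The action of a polynomial `f` on an `n`-dimensional sequence `ℓ`. -/
noncomputable def seqMul {K : Type*} [Field K] {n : ℕ} (f : MvPolynomial (Fin n) K)
    (ℓ : (Fin n →₀ ℕ) → K) : (Fin n →₀ ℕ) → K :=
  fun α => ∑ γ ∈ f.support, coeff γ f * ℓ (γ + α)

/-- The apolarity pairing `⟨P, g⟩ = Σ_α (coeff α P)·(coeff α g)`. -/
noncomputable def apol {K : Type*} [Field K] {n : ℕ} (P g : MvPolynomial (Fin n) K) : K :=
  ∑ α ∈ P.support, coeff α P * coeff α g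

/-- The reciprocal of a polynomial `f` with respect to a degree vector `d`:
`rec_d(f) = Σ_γ (coeff γ f)·X^(d − γ)`. -/
noncomputable def recd {K : Type*} [Field K] {n : ℕ} (d : Fin n →₀ ℕ)
    (f : MvPolynomial (Fin n) K) : MvPolynomial (Fin n) K :=
  ∑ γ ∈ f.support, monomial (d - γ) (coeff γ f)

theorem le_of_mem_support_of_degreeOf_le {σ R : Type*} [CommSemiring R] {d : σ →₀ ℕ}
    {f : MvPolynomial σ R} (hfd : ∀ i, degreeOf i f ≤ d i) {γ : σ →₀ ℕ} (hγ : γ ∈ f.support) :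
    γ ≤ d :=
  fun i => (monomial_le_degreeOf i hγ).trans (hfd i)

section

variable {K : Type*} [Field K] {n : ℕ} {d : Fin n →₀ ℕ} {f : MvPolynomial (Fin n) K}

theorem coeff_recd (hfd : ∀ i, degreeOf i f ≤ d i) (β : Fin n →₀ ℕ) :
    coeff β (recd d f) = if β ≤ d then coeff (d - β) f else 0 := by
  classical
  simp only [recd, coeff_sum, coeff_monomial]
  split_ifs with hβ
  · rw [Finset.sum_eq_single (d - β)]
    · rw [if_pos (tsub_tsub_cancel_of_le hβ)]
    · intro γ hγ hne
      refine if_neg fun h => hne ?_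
      rw [← h, tsub_tsub_cancel_of_le (le_of_mem_support_of_degreeOf_le hfd hγ)]
    · intro h
      rw [notMem_support_iff.mp h, ite_self]
  · refine Finset.sum_eq_zero fun γ _ => if_neg ?_
    rintro rfl
    exact hβ tsub_le_self

theorem coeff_recd_sub (hfd : ∀ i, degreeOf i f ≤ d i) {γ : Fin n →₀ ℕ} (hγ : γ ≤ d) :
    coeff (d - γ) (recd d f) = coeff γ f := by
  rw [coeff_recd hfd, if_pos tsub_le_self, tsub_tsub_cancel_of_le hγ]

theorem le_of_mem_support_recd (hfd : ∀ i, degreeOf i f ≤ d i) {β : Fin n →₀ ℕ}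
    (hβ : β ∈ (recd d f).support) : β ≤ d := by
  by_contra h
  exact mem_support_iff.mp hβ (by rw [coeff_recd hfd, if_neg h])

theorem apol_recd (hfd : ∀ i, degreeOf i f ≤ d i) (g : MvPolynomial (Fin n) K) :
    apol (recd d f) g = ∑ γ ∈ f.support, coeff γ f * coeff (d - γ) g := by
  refine Finset.sum_nbij' (fun β => d - β) (fun γ => d - γ) ?_ ?_ ?_ ?_ ?_
  · intro β hβ
    have hle := le_of_mem_support_recd hfd hβ
    rwa [mem_support_iff, coeff_recd hfd, if_pos hle, ← mem_support_iff] at hβ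
  · intro γ hγ
    rw [mem_support_iff, coeff_recd_sub hfd (le_of_mem_support_of_degreeOf_le hfd hγ)]
    exact mem_support_iff.mp hγ
  · exact fun β hβ => tsub_tsub_cancel_of_le (le_of_mem_support_recd hfd hβ)
  · exact fun γ hγ => tsub_tsub_cancel_of_le (le_of_mem_support_of_degreeOf_le hfd hγ)
  · intro β hβ
    have hle := le_of_mem_support_recd hfd hβ
    rw [coeff_recd hfd, if_pos hle, tsub_tsub_cancel_of_le hle]

/-- Pairing `rec_d(f)` with `X^τ · rec_d(p)` evaluates the sequence `f · p` at `τ`. -/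
theorem apol_recd_monomial_mul_recd {p : MvPolynomial (Fin n) K}
    (hfd : ∀ i, degreeOf i f ≤ d i) (hpd : ∀ i, degreeOf i p ≤ d i) (τ : Fin n →₀ ℕ) :
    apol (recd d f) (monomial τ 1 * recd d p) = seqMul f (fun γ => coeff γ p) τ := by
  classical
  rw [apol_recd hfd, seqMul]
  refine Finset.sum_congr rfl fun γ hγ => ?_
  have hle := le_of_mem_support_of_degreeOf_le hfd hγ
  rw [coeff_monomial_mul', one_mul]
  congr 1
  split_ifs with h
  · rw [tsub_tsub, coeff_recd_sub hpd]
    rwa [add_comm, ← le_tsub_iff_right hle]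
  · refine (notMem_support_iff.mp fun hmem => h ?_).symm
    rw [le_tsub_iff_right hle, add_comm]
    exact le_of_mem_support_of_degreeOf_le hpd hmem

theorem apol_add_right (P g h : MvPolynomial (Fin n) K) :
    apol P (g + h) = apol P g + apol P h := by
  simp only [apol, coeff_add, mul_add, Finset.sum_add_distrib]

theorem apol_C_mul_right (P g : MvPolynomial (Fin n) K) (c : K) :
    apol P (C c * g) = c * apol P g := by
  simp only [apol, coeff_C_mul, Finset.mul_sum, mul_left_comm]

/-- Orthogonality to a principal ideal can be tested on monomial multiples of the generator. -/
theorem forall_mem_span_singleton_apol_eq_zero_iff (P q : MvPolynomial (Fin n) K) :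
    (∀ g ∈ Ideal.span {q}, apol P g = 0) ↔
      ∀ τ : Fin n →₀ ℕ, apol P (monomial τ 1 * q) = 0 := by
  refine ⟨fun h τ => h _ (Ideal.mul_mem_left _ _ (Ideal.mem_span_singleton_self q)), ?_⟩
  intro h g hg
  obtain ⟨a, rfl⟩ := Ideal.mem_span_singleton'.mp hg
  induction a using MvPolynomial.induction_on' with
  | monomial τ c =>
    rw [← mul_one c, ← C_mul_monomial, mul_assoc, apol_C_mul_right, h, mul_zero]
  | add a b ha hb =>
    rw [add_mul, apol_add_right,
      ha (Ideal.mul_mem_left _ _ (Ideal.mem_span_singleton_self q)),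
      hb (Ideal.mul_mem_left _ _ (Ideal.mem_span_singleton_self q)), add_zero]

end

/-- Let `ℓ` be a nonzero `n`-dimensional sequence with finite support, `p_ℓ` its generating
polynomial and `d` the multidegree of `p_ℓ`. For every nonzero polynomial `f` with
`degreeOf i f ≤ d i` for all `i`: `f ∈ ann(ℓ)` iff `rec_d(f)` lies in the orthogonal, under
the apolarity pairing, of the principal ideal generated by `rec(p_ℓ)`; equivalently, iff
`⟨rec_d(f), X^τ · rec(p_ℓ)⟩ = 0` for every exponent vector `τ`. -/
theorem ann_iff_rec_orthogonal {K : Type*} [Field K] {n : ℕ} (hn : 1 ≤ n)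
    (ℓ : (Fin n →₀ ℕ) → K) (hℓ : ℓ ≠ 0)
    (p : MvPolynomial (Fin n) K) (hp : ∀ γ, coeff γ p = ℓ γ)
    (d : Fin n →₀ ℕ) (hd : ∀ i, d i = degreeOf i p)
    (f : MvPolynomial (Fin n) K) (hf : f ≠ 0) (hfd : ∀ i, degreeOf i f ≤ d i) :
    (seqMul f ℓ = 0 ↔ ∀ g ∈ Ideal.span {recd d p}, apol (recd d f) g = 0) ∧
    (seqMul f ℓ = 0 ↔ ∀ τ : Fin n →₀ ℕ, apol (recd d f) (monomial τ 1 * recd d p) = 0) := by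
  obtain rfl : (fun γ => coeff γ p) = ℓ := funext hp
  rw [forall_mem_span_singleton_apol_eq_zero_iff, and_self]
  simp only [apol_recd_monomial_mul_recd hfd fun i => (hd i).ge, funext_iff, Pi.zero_apply]
end

section
/- Let S ⊆ (Fin n →₀ ℕ) be a finite nonempty downward closed set, let d be the componentwise supremum of S, and let ℓ be an n-dimensional sequence with ℓ(γ) = 0 for all γ ∉ S and ℓ(d) ≠ 0. Then ann(ℓ) equals the ideal of K[x_1,…,x_n] generated by the monomials X^β with β ∉ S (equivalently, by the border monomials X^β with β ∉ S such that β − e_i ∈ S for some i with β(i) > 0). -/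
open MvPolynomial

/-- Every exponent outside a finite set containing `0` lies above a border exponent. -/
theorem exists_border_le {n : ℕ} {S : Finset (Fin n →₀ ℕ)} (h0 : 0 ∈ S)
    {β : Fin n →₀ ℕ} (hβ : β ∉ S) :
    ∃ γ, (γ ∉ S ∧ ∃ i : Fin n, 0 < γ i ∧ γ - Finsupp.single i 1 ∈ S) ∧ γ ≤ β := by
  obtain ⟨γ, hγβ, hγ⟩ := exists_minimal_le_of_wellFoundedLT (fun γ => γ ∉ S) β hβ
  have hγ0 : γ ≠ 0 := fun h => hγ.prop (h ▸ h0)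
  obtain ⟨i, hi⟩ := Finsupp.ne_iff.mp hγ0
  have hi : 0 < γ i := Nat.pos_of_ne_zero hi
  refine ⟨γ, ⟨hγ.prop, i, hi, ?_⟩, hγβ⟩
  by_contra hmem
  have hle := hγ.le_of_le hmem tsub_le_self i
  simp only [Finsupp.tsub_apply, Finsupp.single_eq_same] at hle
  omega

/-- If `ℓ` is supported on `S ⊆ [0, d]`, with `S` downward closed and `ℓ d ≠ 0`, then `f`
annihilates `ℓ` if and only if no exponent of `f` lies in `S`. -/
theorem seqMul_eq_zero_iff {K : Type*} [Field K] {n : ℕ} {S : Finset (Fin n →₀ ℕ)}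
    (hdc : ∀ β ∈ S, ∀ γ ≤ β, γ ∈ S) {d : Fin n →₀ ℕ} (hle : ∀ β ∈ S, β ≤ d)
    {ℓ : (Fin n →₀ ℕ) → K} (hsupp : ∀ γ ∉ S, ℓ γ = 0) (hℓd : ℓ d ≠ 0)
    (f : MvPolynomial (Fin n) K) :
    seqMul f ℓ = 0 ↔ ∀ γ ∈ f.support, γ ∉ S := by
  constructor
  · intro hf γ₀ hγ₀ hγ₀S
    obtain ⟨γ, -, hγ⟩ := exists_minimal_le_of_wellFoundedLT
      (fun γ => γ ∈ f.support ∧ γ ∈ S) γ₀ ⟨hγ₀, hγ₀S⟩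
    obtain ⟨hγf, hγS⟩ := hγ.prop
    have hsum : seqMul f ℓ (d - γ) = coeff γ f * ℓ d := by
      unfold seqMul
      rw [Finset.sum_eq_single_of_mem γ hγf, add_tsub_cancel_of_le (hle γ hγS)]
      intro γ' hγ'f hne
      rw [hsupp, mul_zero]
      intro hmem
      have hγ'S : γ' ∈ S := hdc _ hmem _ le_self_add
      have hγ'γ : γ' ≤ γ := by
        intro i
        have h₁ := hle _ hmem i
        have h₂ := hle γ hγS i
        simp only [Finsupp.add_apply, Finsupp.tsub_apply] at h₁
        omega
      exact hne (le_antisymm hγ'γ (hγ.le_of_le ⟨hγ'f, hγ'S⟩ hγ'γ))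
    rw [hf] at hsum
    exact mul_ne_zero (mem_support_iff.mp hγf) hℓd hsum.symm
  · intro hf
    funext α
    refine Finset.sum_eq_zero fun γ hγ => ?_
    rw [hsupp _ fun hmem => hf γ hγ (hdc _ hmem _ le_self_add), mul_zero]

/-- Let `S` be a finite nonempty downward closed set of exponent vectors, `d` its
componentwise supremum, and `ℓ` a sequence vanishing outside `S` with `ℓ d ≠ 0`.
Then `ann(ℓ)` equals the ideal generated by the monomials `X^β` with `β ∉ S`
(equivalently, by the border monomials: those `β ∉ S` with `β − e_i ∈ S` for some `i`
with `β i > 0`). -/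
theorem ann_eq_span_of_corner_nonzero {K : Type*} [Field K] {n : ℕ} (hn : 1 ≤ n)
    (S : Finset (Fin n →₀ ℕ)) (hSne : S.Nonempty)
    (hdc : ∀ β ∈ S, ∀ γ ≤ β, γ ∈ S)
    (d : Fin n →₀ ℕ) (hd : ∀ i, d i = S.sup fun β => β i)
    (ℓ : (Fin n →₀ ℕ) → K) (hsupp : ∀ γ ∉ S, ℓ γ = 0) (hℓd : ℓ d ≠ 0) :
    {f : MvPolynomial (Fin n) K | seqMul f ℓ = 0} =
      (Ideal.span ((fun β : Fin n →₀ ℕ => (monomial β (1 : K))) '' {β | β ∉ S}) :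
        Set (MvPolynomial (Fin n) K)) ∧
    {f : MvPolynomial (Fin n) K | seqMul f ℓ = 0} =
      (Ideal.span ((fun β : Fin n →₀ ℕ => (monomial β (1 : K))) ''
          {β | β ∉ S ∧ ∃ i : Fin n, 0 < β i ∧ β - Finsupp.single i 1 ∈ S}) :
        Set (MvPolynomial (Fin n) K)) := by
  have hle : ∀ β ∈ S, β ≤ d := fun β hβ i => by
    rw [hd i]
    exact Finset.le_sup (f := fun β : Fin n →₀ ℕ => β i) hβ
  have h0 : (0 : Fin n →₀ ℕ) ∈ S := by
    obtain ⟨β, hβ⟩ := hSne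
    exact hdc β hβ 0 zero_le
  constructor
  · ext f
    rw [Set.mem_ofPred_eq, seqMul_eq_zero_iff hdc hle hsupp hℓd, SetLike.mem_coe,
      mem_ideal_span_monomial_image]
    exact forall₂_congr fun γ _ => ⟨fun h => ⟨γ, h, le_rfl⟩,
      fun ⟨β, hβ, hβγ⟩ h => hβ (hdc γ h β hβγ)⟩
  · ext f
    rw [Set.mem_ofPred_eq, seqMul_eq_zero_iff hdc hle hsupp hℓd, SetLike.mem_coe,
      mem_ideal_span_monomial_image]
    exact forall₂_congr fun γ _ => ⟨fun h => exists_border_le h0 h,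
      fun ⟨β, hβ, hβγ⟩ h => hβ.1 (hdc γ h β hβγ)⟩
end

section
/- Let S ⊆ (Fin n →₀ ℕ) be a finite nonempty downward closed set, let d be the componentwise supremum of S, and let ℓ be an n-dimensional sequence with ℓ(γ) = 0 for all γ ∉ S and ℓ(d) ≠ 0. If f ∈ ann(ℓ) and every exponent vector in the support of f lies in S, then f = 0. -/
open MvPolynomial

/-- Let `S` be a finite nonempty downward closed set of exponent vectors, `d` its
componentwise supremum, and `ℓ` a sequence vanishing outside `S` with `ℓ d ≠ 0`.
If `f ∈ ann(ℓ)` and the support of `f` lies in `S`, then `f = 0`. -/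
theorem ann_supported_in_S_eq_zero {K : Type*} [Field K] {n : ℕ} (hn : 1 ≤ n)
    (S : Finset (Fin n →₀ ℕ)) (hSne : S.Nonempty)
    (hdc : ∀ β ∈ S, ∀ γ ≤ β, γ ∈ S)
    (d : Fin n →₀ ℕ) (hd : ∀ i, d i = S.sup fun β => β i)
    (ℓ : (Fin n →₀ ℕ) → K) (hsupp : ∀ γ ∉ S, ℓ γ = 0) (hℓd : ℓ d ≠ 0)
    (f : MvPolynomial (Fin n) K) (hf : seqMul f ℓ = 0)
    (hfS : ∀ γ ∈ f.support, γ ∈ S) :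
    f = 0 := by
  have le_d : ∀ γ ∈ S, γ ≤ d := fun γ hγ i => by
    rw [hd i]
    exact Finset.le_sup (f := fun β : Fin n →₀ ℕ => β i) hγ
  by_contra hf0
  obtain ⟨γ₀, hγ₀⟩ := f.support.exists_minimal (support_nonempty.mpr hf0)
  have hadd : γ₀ + (d - γ₀) = d := add_tsub_cancel_of_le (le_d γ₀ (hfS γ₀ hγ₀.prop))
  have heval : seqMul f ℓ (d - γ₀) = coeff γ₀ f * ℓ d := by
    unfold seqMul
    rw [Finset.sum_eq_single_of_mem γ₀ hγ₀.prop, hadd]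
    intro γ hγ hne
    rw [hsupp, mul_zero]
    intro hmem
    have hle : γ + (d - γ₀) ≤ γ₀ + (d - γ₀) := hadd.symm ▸ le_d _ hmem
    exact hne (hγ₀.eq_of_le hγ (le_of_add_le_add_right hle))
  rw [hf] at heval
  exact mul_ne_zero (mem_support_iff.mp hγ₀.prop) hℓd heval.symm
end

section
/- Let ℓ be a nonzero n-dimensional sequence with finite support. Then ann(ℓ) is a proper ideal of K[x_1,…,x_n] and there exists N such that m^N ⊆ ann(ℓ), where m is the maximal ideal generated by x_1,…,x_n; consequently the radical of ann(ℓ) equals m, i.e., ann(ℓ) is an m-primary ideal. -/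
open MvPolynomial

/-- The constant polynomial `1` acts trivially on sequences. -/
theorem seqMul_one {K : Type*} [Field K] {n : ℕ} (ℓ : (Fin n →₀ ℕ) → K) :
    seqMul 1 ℓ = ℓ := by
  classical
  funext α
  have hsupp : (1 : MvPolynomial (Fin n) K).support = {0} := by
    rw [← C_1, support_C, if_neg one_ne_zero]
  simp [seqMul, hsupp]

/-- A polynomial all of whose monomials have degree exceeding that of every index in the support
of `ℓ` annihilates `ℓ`. -/
theorem seqMul_eq_zero_of_degree_lt {K : Type*} [Field K] {n : ℕ} {ℓ : (Fin n →₀ ℕ) → K}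
    {f : MvPolynomial (Fin n) K} {N : ℕ} (hℓ : ∀ β, ℓ β ≠ 0 → β.degree < N)
    (hf : ∀ γ ∈ f.support, N ≤ γ.degree) : seqMul f ℓ = 0 := by
  funext α
  refine Finset.sum_eq_zero fun γ hγ => ?_
  by_contra h
  have hlt := hℓ _ (right_ne_zero_of_mul h)
  have hle := hf γ hγ
  rw [map_add] at hlt
  omega

/-- Over a field, the ideal generated by the variables is maximal. -/
theorem isMaximal_span_range_X (σ K : Type*) [Field K] :
    (Ideal.span (Set.range X) : Ideal (MvPolynomial σ K)).IsMaximal := by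
  have hker : (Ideal.span (Set.range X) : Ideal (MvPolynomial σ K)) =
      RingHom.ker (constantCoeff : MvPolynomial σ K →+* K) := by
    ext f
    rw [← pow_one (Ideal.span _), mem_pow_idealOfVars_iff', RingHom.mem_ker,
      constantCoeff_eq]
    simp [Finsupp.degree_eq_zero_iff]
  rw [hker]
  exact RingHom.ker_isMaximal_of_surjective _ fun a => ⟨C a, constantCoeff_C σ a⟩

/-- Let `ℓ` be a nonzero `n`-dimensional sequence with finite support. Then `ann(ℓ)`
is a proper ideal, some power of the maximal ideal `m = ⟨x₁,…,xₙ⟩` is contained in it,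
and its radical equals `m`; i.e. `ann(ℓ)` is an `m`-primary ideal. -/
theorem ann_is_m_primary {K : Type*} [Field K] {n : ℕ} (hn : 1 ≤ n)
    (ℓ : (Fin n →₀ ℕ) → K) (hℓ : ℓ ≠ 0) (hfin : (Function.support ℓ).Finite)
    (I : Ideal (MvPolynomial (Fin n) K))
    (hI : (I : Set (MvPolynomial (Fin n) K)) = {f | seqMul f ℓ = 0}) :
    I ≠ ⊤ ∧
    (∃ N : ℕ, (Ideal.span (Set.range X) : Ideal (MvPolynomial (Fin n) K)) ^ N ≤ I) ∧
    I.radical = Ideal.span (Set.range X) := by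
  have hmem (f : MvPolynomial (Fin n) K) : f ∈ I ↔ seqMul f ℓ = 0 := by
    rw [← SetLike.mem_coe, hI, Set.mem_ofPred_eq]
  have hproper : I ≠ ⊤ := by
    rwa [Ideal.ne_top_iff_one, hmem, seqMul_one]
  obtain ⟨N, hN⟩ : ∃ N : ℕ,
      (Ideal.span (Set.range X) : Ideal (MvPolynomial (Fin n) K)) ^ N ≤ I := by
    obtain ⟨B, hB⟩ := (hfin.image Finsupp.degree).bddAbove
    refine ⟨B + 1, fun f hf => (hmem f).2 (seqMul_eq_zero_of_degree_lt (N := B + 1) ?_ ?_)⟩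
    · exact fun β hβ => Nat.lt_succ_of_le (hB ⟨β, hβ, rfl⟩)
    · exact (mem_pow_idealOfVars_iff _ _).1 hf
  refine ⟨hproper, ⟨N, hN⟩, ?_⟩
  refine ((isMaximal_span_range_X (Fin n) K).eq_of_le ?_ ?_).symm
  · rwa [Ne, Ideal.radical_eq_top]
  · exact fun f hf => ⟨N, hN (Ideal.pow_mem_pow hf N)⟩
end

section
/- Let ℓ be an n-dimensional sequence and let S ⊆ (Fin n →₀ ℕ) be a finite downward closed set containing the support of ℓ. Let W be the K-linear span in MvPolynomial (Fin n) K of the monomials X^γ with γ ∈ S. Then the dimension over K of the subspace ann(ℓ) ∩ W equals |S| minus the dimension over K of the quotient ring K[x_1,…,x_n]/ann(ℓ). -/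
open MvPolynomial

theorem seqMul_monomial_eq_zero {K : Type*} [Field K] {n : ℕ} {ℓ : (Fin n →₀ ℕ) → K}
    {γ : Fin n →₀ ℕ} (h : ∀ α, ℓ (γ + α) = 0) (c : K) : seqMul (monomial γ c) ℓ = 0 := by
  funext α
  refine Finset.sum_eq_zero fun δ hδ => ?_
  rw [Finset.mem_singleton.mp (support_monomial_subset hδ), h, mul_zero]

theorem finrank_span_monomial_image {σ K : Type*} [Field K] (S : Finset (σ →₀ ℕ)) :
    Module.finrank K (Submodule.span K
      ((fun γ : σ →₀ ℕ => (monomial γ (1 : K))) '' ↑S)) = S.card := by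
  have hli : LinearIndependent K (fun γ : S => monomial (γ : σ →₀ ℕ) (1 : K)) := by
    simpa [Function.comp_def] using
      (basisMonomials σ K).linearIndependent.comp ((↑) : S → (σ →₀ ℕ)) Subtype.val_injective
  have h := finrank_span_eq_card hli
  rw [Fintype.card_coe] at h
  rw [← h, Set.image_eq_range]
  rfl

theorem finrank_inf_add_finrank_quotient {K R : Type*} [Field K] [CommRing R] [Algebra K R]
    (I : Ideal R) (W : Submodule K R) [FiniteDimensional K W]
    (h : W ⊔ I.restrictScalars K = ⊤) :
    Module.finrank K ↥(I.restrictScalars K ⊓ W) + Module.finrank K (R ⧸ I) =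
      Module.finrank K W := by
  let g : W →ₗ[K] R ⧸ I := (Ideal.Quotient.mkₐ K I).toLinearMap ∘ₗ W.subtype
  have hsurj : Function.Surjective g := by
    intro q
    obtain ⟨f, rfl⟩ := Ideal.Quotient.mk_surjective q
    obtain ⟨w, hw, i, hi, rfl⟩ := Submodule.mem_sup.mp (h ▸ Submodule.mem_top : f ∈ _)
    refine ⟨⟨w, hw⟩, ?_⟩
    have hi' : Ideal.Quotient.mk I i = 0 := Ideal.Quotient.eq_zero_iff_mem.mpr hi
    simp [g, hi']
  have hker : LinearMap.ker g = (I.restrictScalars K ⊓ W).comap W.subtype := by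
    ext w
    simp [g, Ideal.Quotient.eq_zero_iff_mem]
  have hrn := g.finrank_range_add_finrank_ker
  rw [LinearMap.range_eq_top.mpr hsurj, finrank_top, hker,
    (Submodule.comapSubtypeEquivOfLe inf_le_right).finrank_eq] at hrn
  rw [add_comm, hrn]

/-- Let `ℓ` be an `n`-dimensional sequence and `S` a finite downward closed set containing
the support of `ℓ`. Let `W` be the span of the monomials `X^γ`, `γ ∈ S`. Then
`dim_K (ann(ℓ) ∩ W) = |S| − dim_K (K[x₁,…,xₙ]/ann(ℓ))`. -/
theorem dim_ann_inter_span {K : Type*} [Field K] {n : ℕ} (hn : 1 ≤ n)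
    (ℓ : (Fin n →₀ ℕ) → K)
    (S : Finset (Fin n →₀ ℕ)) (hdc : ∀ β ∈ S, ∀ γ ≤ β, γ ∈ S)
    (hsupp : ∀ γ : Fin n →₀ ℕ, ℓ γ ≠ 0 → γ ∈ S)
    (I : Ideal (MvPolynomial (Fin n) K))
    (hI : (I : Set (MvPolynomial (Fin n) K)) = {f | seqMul f ℓ = 0}) :
    Module.finrank K
        ↥(I.restrictScalars K ⊓
          Submodule.span K ((fun γ : Fin n →₀ ℕ => (monomial γ (1 : K))) '' ↑S)) =
      S.card - Module.finrank K (MvPolynomial (Fin n) K ⧸ I) := by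
  set W := Submodule.span K ((fun γ : Fin n →₀ ℕ => (monomial γ (1 : K))) '' (S : Set _))
  have : FiniteDimensional K W := FiniteDimensional.span_of_finite K (S.finite_toSet.image _)
  have htop : W ⊔ I.restrictScalars K = ⊤ := by
    refine eq_top_iff.mpr fun f _ => ?_
    rw [f.as_sum]
    refine Submodule.sum_mem _ fun γ _ => ?_
    by_cases hγ : γ ∈ S
    · refine Submodule.mem_sup_left ?_
      rw [← mul_one (coeff γ f), ← smul_eq_mul, ← smul_monomial]
      exact W.smul_mem _ (Submodule.subset_span ⟨γ, hγ, rfl⟩)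
    · refine Submodule.mem_sup_right ?_
      have hmem : monomial γ (coeff γ f) ∈ (I : Set (MvPolynomial (Fin n) K)) := by
        rw [hI]
        refine seqMul_monomial_eq_zero (fun α => ?_) _
        by_contra hne
        exact hγ (hdc _ (hsupp _ hne) _ le_self_add)
      exact hmem
  have hdim := finrank_inf_add_finrank_quotient I W htop
  rw [finrank_span_monomial_image S] at hdim
  omega
end

section
/- Let ℓ be an n-dimensional sequence and b a polynomial in MvPolynomial (Fin n) K. Then x_i · b ∈ ann(ℓ) for every variable x_i (i = 1,…,n) if and only if (b·ℓ)(α) = 0 for every nonzero exponent vector α. Consequently, b ∈ ann(ℓ) if and only if x_i·b ∈ ann(ℓ) for all i and additionally Σ_γ (coeff γ b)·ℓ(γ) = 0. -/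
open MvPolynomial

/-- Multiplying by a variable shifts the resulting sequence by one step in that direction. -/
theorem seqMul_X_mul_apply {K : Type*} [Field K] {n : ℕ} (i : Fin n)
    (f : MvPolynomial (Fin n) K) (ℓ : (Fin n →₀ ℕ) → K) (α : Fin n →₀ ℕ) :
    seqMul (X i * f) ℓ α = seqMul f ℓ (Finsupp.single i 1 + α) := by
  simp only [seqMul, support_X_mul, Finset.sum_map, addLeftEmbedding_apply, coeff_X_mul]
  exact Finset.sum_congr rfl fun γ _ => by rw [add_assoc, add_left_comm]

theorem forall_seqMul_X_mul_eq_zero_iff {K : Type*} [Field K] {n : ℕ}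
    (ℓ : (Fin n →₀ ℕ) → K) (f : MvPolynomial (Fin n) K) :
    (∀ i : Fin n, seqMul (X i * f) ℓ = 0) ↔
      ∀ α : Fin n →₀ ℕ, α ≠ 0 → seqMul f ℓ α = 0 := by
  constructor
  · intro h α hα
    obtain ⟨i, hi⟩ := Finsupp.ne_iff.mp hα
    have hle : Finsupp.single i 1 ≤ α :=
      Finsupp.single_le_iff.mpr (Nat.one_le_iff_ne_zero.mpr hi)
    rw [← add_tsub_cancel_of_le hle, ← seqMul_X_mul_apply, h i, Pi.zero_apply]
  · intro h i
    funext α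
    rw [seqMul_X_mul_apply]
    exact h _ (by simp)

/-- For a sequence `ℓ` and a polynomial `b`: `x_i · b ∈ ann(ℓ)` for every variable `x_i`
iff `(b·ℓ)(α) = 0` for every nonzero exponent vector `α`. Consequently, `b ∈ ann(ℓ)` iff
`x_i · b ∈ ann(ℓ)` for all `i` and additionally `Σ_γ (coeff γ b)·ℓ(γ) = 0`. -/
theorem ann_closed_under_multiplication {K : Type*} [Field K] {n : ℕ} (hn : 1 ≤ n)
    (ℓ : (Fin n →₀ ℕ) → K) (b : MvPolynomial (Fin n) K) :
    ((∀ i : Fin n, seqMul (X i * b) ℓ = 0) ↔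
      ∀ α : Fin n →₀ ℕ, α ≠ 0 → seqMul b ℓ α = 0) ∧
    (seqMul b ℓ = 0 ↔
      (∀ i : Fin n, seqMul (X i * b) ℓ = 0) ∧ ∑ γ ∈ b.support, coeff γ b * ℓ γ = 0) := by
  refine ⟨forall_seqMul_X_mul_eq_zero_iff ℓ b, ?_⟩
  have hzero : ∑ γ ∈ b.support, coeff γ b * ℓ γ = seqMul b ℓ 0 := by
    simp only [seqMul, add_zero]
  rw [forall_seqMul_X_mul_eq_zero_iff, hzero]
  refine ⟨fun h => by simp [h], fun ⟨hne, h0⟩ => funext fun α => ?_⟩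
  rcases eq_or_ne α 0 with rfl | hα
  exacts [h0, hne α hα]
end
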